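/- In Mat_P(ℂ) the identity q·R·F+ − F+·R − F0·R + (q−1)^{−1}·(q^{n/2+1}·K1·K2^{−1} − q^{k/2}·K1 − q^{(n−k)/2}·K2 + I)·R = 0 holds. -/

import Mathlib

open scoped Classical

noncomputable section

variable {F V : Type} [Field F] [AddCommGroup V] [Module F V]

/-- `v` covers `u` in the projective geometry `P`. -/
def Covers (u v : Submodule F V) : Prop :=
  u ≤ v ∧ Module.finrank F ↥v = Module.finrank F ↥u + 1

/-- `v` slash-covers `u` (relative to the fixed subspace `y`). -/
def SlashCovers (y u v : Submodule F V) : Prop :=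
  Covers u v ∧ Module.finrank F ↥(v ⊓ y) = Module.finrank F ↥(u ⊓ y) + 1

/-- `v` backslash-covers `u` (relative to the fixed subspace `y`). -/
def BackslashCovers (y u v : Submodule F V) : Prop :=
  Covers u v ∧ Module.finrank F ↥(v ⊓ y) = Module.finrank F ↥(u ⊓ y)

/-- `q` raised to a real exponent, as a complex number. -/
def qpow (q : ℕ) (e : ℝ) : ℂ := (((q : ℝ) ^ e : ℝ) : ℂ)

/-- The Gaussian bracket `[m] = (q^m - 1)/(q - 1)` as a rational number. -/
def gaussQ (q m : ℕ) : ℚ := ((q : ℚ) ^ m - 1) / ((q : ℚ) - 1)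

/-- The Gaussian bracket `[m] = (q^m - 1)/(q - 1)` as a complex number. -/
def gaussC (q m : ℕ) : ℂ := ((q : ℂ) ^ m - 1) / ((q : ℂ) - 1)

/-- The diagonal matrix `K1`; the `(u,u)` entry is `q^(k/2 - i)` for `u ∈ P_{i,j}`. -/
def matK1 (q k : ℕ) (y : Submodule F V) : Matrix (Submodule F V) (Submodule F V) ℂ :=
  Matrix.diagonal fun u => qpow q ((k : ℝ) / 2 - (Module.finrank F ↥(u ⊓ y) : ℝ))

/-- The diagonal matrix `K2`; the `(u,u)` entry is `q^(j - (n-k)/2)` for `u ∈ P_{i,j}`. -/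
def matK2 (q n k : ℕ) (y : Submodule F V) : Matrix (Submodule F V) (Submodule F V) ℂ :=
  Matrix.diagonal fun u =>
    qpow q (((Module.finrank F ↥u : ℝ) - (Module.finrank F ↥(u ⊓ y) : ℝ))
      - ((n : ℝ) - (k : ℝ)) / 2)

/-- The 0-1 matrix `L1`; the `(u,v)` entry is `1` iff `v` slash-covers `u`. -/
def matL1 (y : Submodule F V) : Matrix (Submodule F V) (Submodule F V) ℂ :=
  Matrix.of fun u v => if SlashCovers y u v then (1 : ℂ) else 0

/-- The 0-1 matrix `L2`; the `(u,v)` entry is `1` iff `v` backslash-covers `u`. -/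
def matL2 (y : Submodule F V) : Matrix (Submodule F V) (Submodule F V) ℂ :=
  Matrix.of fun u v => if BackslashCovers y u v then (1 : ℂ) else 0

/-- `R1 = L1ᵀ`. -/
def matR1 (y : Submodule F V) : Matrix (Submodule F V) (Submodule F V) ℂ := Matrix.transpose (matL1 y)

/-- `R2 = L2ᵀ`. -/
def matR2 (y : Submodule F V) : Matrix (Submodule F V) (Submodule F V) ℂ := Matrix.transpose (matL2 y)

/-- `R = L1 · R2`. -/
def matR [Fintype (Submodule F V)] (y : Submodule F V) :
    Matrix (Submodule F V) (Submodule F V) ℂ := matL1 y * matR2 y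

/-- `L = R1 · L2`. -/
def matL [Fintype (Submodule F V)] (y : Submodule F V) :
    Matrix (Submodule F V) (Submodule F V) ℂ := matR1 y * matL2 y

/-- The 0-1 matrix `F0`. -/
def matF0 (y : Submodule F V) : Matrix (Submodule F V) (Submodule F V) ℂ :=
  Matrix.of fun u v =>
    if SlashCovers y u (u ⊔ v) ∧ SlashCovers y v (u ⊔ v) ∧
        BackslashCovers y (u ⊓ v) u ∧ BackslashCovers y (u ⊓ v) v then (1 : ℂ) else 0

/-- The 0-1 matrix `F+`. -/
def matFp (y : Submodule F V) : Matrix (Submodule F V) (Submodule F V) ℂ :=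
  Matrix.of fun u v =>
    if BackslashCovers y u (u ⊔ v) ∧ BackslashCovers y v (u ⊔ v) then (1 : ℂ) else 0

/-- The 0-1 matrix `F-`. -/
def matFm (y : Submodule F V) : Matrix (Submodule F V) (Submodule F V) ℂ :=
  Matrix.of fun u v =>
    if SlashCovers y (u ⊓ v) u ∧ SlashCovers y (u ⊓ v) v then (1 : ℂ) else 0

/-- The vertex set `X` of the Grassmann graph: `k`-dimensional subspaces of `V`. -/
abbrev GrassVertex (F V : Type) [Field F] [AddCommGroup V] [Module F V] (k : ℕ) :=
  {z : Submodule F V // Module.finrank F ↥z = k}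

/-- The Grassmann graph `J_q(n,k)`: vertices are adjacent iff their intersection
has dimension `k - 1`. -/
def Grass (F V : Type) [Field F] [AddCommGroup V] [Module F V] (k : ℕ) :
    SimpleGraph (GrassVertex F V k) :=
  SimpleGraph.fromRel fun a b => Module.finrank F ↥(a.1 ⊓ b.1) = k - 1

/-- `B_xy = {z ∈ Γ(x) : ∂(z,y) = ∂(x,y) + 1}`. -/
def Bset {k : ℕ} (x y : GrassVertex F V k) : Set (GrassVertex F V k) :=
  {z | (Grass F V k).Adj x z ∧ (Grass F V k).dist z y = (Grass F V k).dist x y + 1}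

/-- `C_xy = {z ∈ Γ(x) : ∂(z,y) = ∂(x,y) - 1}`. -/
def Cset {k : ℕ} (x y : GrassVertex F V k) : Set (GrassVertex F V k) :=
  {z | (Grass F V k).Adj x z ∧ (Grass F V k).dist z y = (Grass F V k).dist x y - 1}

/-- `A_xy = {z ∈ Γ(x) : ∂(z,y) = ∂(x,y)}`. -/
def Aset {k : ℕ} (x y : GrassVertex F V k) : Set (GrassVertex F V k) :=
  {z | (Grass F V k).Adj x z ∧ (Grass F V k).dist z y = (Grass F V k).dist x y}

/-- `A0_xy`. -/
def A0set {k : ℕ} (x y : GrassVertex F V k) : Set (GrassVertex F V k) :=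
  {z | (Grass F V k).Adj x z ∧
    SlashCovers y.1 z.1 (z.1 ⊔ x.1) ∧ SlashCovers y.1 x.1 (z.1 ⊔ x.1) ∧
    BackslashCovers y.1 (z.1 ⊓ x.1) z.1 ∧ BackslashCovers y.1 (z.1 ⊓ x.1) x.1}

/-- `A+_xy`. -/
def Apset {k : ℕ} (x y : GrassVertex F V k) : Set (GrassVertex F V k) :=
  {z | (Grass F V k).Adj x z ∧
    BackslashCovers y.1 z.1 (z.1 ⊔ x.1) ∧ BackslashCovers y.1 x.1 (z.1 ⊔ x.1)}

/-- `A-_xy`. -/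
def Amset {k : ℕ} (x y : GrassVertex F V k) : Set (GrassVertex F V k) :=
  {z | (Grass F V k).Adj x z ∧
    SlashCovers y.1 (z.1 ⊓ x.1) z.1 ∧ SlashCovers y.1 (z.1 ⊓ x.1) x.1}

/-- The edge `wz` has type `0`. -/
def EdgeType0 {k : ℕ} (y w z : GrassVertex F V k) : Prop :=
  SlashCovers y.1 w.1 (w.1 ⊔ z.1) ∧ SlashCovers y.1 z.1 (w.1 ⊔ z.1) ∧
  BackslashCovers y.1 (w.1 ⊓ z.1) w.1 ∧ BackslashCovers y.1 (w.1 ⊓ z.1) z.1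

/-- The edge `wz` has type `+`. -/
def EdgeTypeP {k : ℕ} (y w z : GrassVertex F V k) : Prop :=
  BackslashCovers y.1 w.1 (w.1 ⊔ z.1) ∧ BackslashCovers y.1 z.1 (w.1 ⊔ z.1)

/-- The edge `wz` has type `-`. -/
def EdgeTypeM {k : ℕ} (y w z : GrassVertex F V k) : Prop :=
  SlashCovers y.1 (w.1 ⊓ z.1) w.1 ∧ SlashCovers y.1 (w.1 ⊓ z.1) z.1

section CoverLemmas

variable {u v w y : Submodule F V}

theorem CovBy.sup_inf_eq (h : u ⋖ v) (hy : ¬ v ⊓ y ≤ u) : u ⊔ v ⊓ y = v :=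
  (h.eq_or_eq le_sup_left (sup_le h.le inf_le_left)).resolve_left
    fun h' => hy (h' ▸ le_sup_right)

theorem CovBy.eq_sup_of_ne (hu : u ⋖ w) (hv : v ⋖ w) (huv : u ≠ v) : w = u ⊔ v := by
  refine ((hu.eq_or_eq le_sup_left (sup_le hu.le hv.le)).resolve_left fun h => ?_).symm
  have hvu : v ≤ u := sup_eq_left.1 h
  exact (hv.eq_or_eq hvu hu.le).elim huv hu.lt.ne

theorem CovBy.eq_inf_of_ne (hu : w ⋖ u) (hv : w ⋖ v) (huv : u ≠ v) : w = u ⊓ v := by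
  refine ((hu.eq_or_eq (le_inf hu.le hv.le) inf_le_left).resolve_right fun h => ?_).symm
  have huv' : u ≤ v := inf_eq_left.1 h
  exact (hv.eq_or_eq hu.le huv').elim hu.lt.ne' huv

variable [FiniteDimensional F V]

theorem covers_iff_covBy : Covers u v ↔ u ⋖ v := by
  constructor
  · rintro ⟨huv, hd⟩
    refine ⟨lt_of_le_of_ne huv fun h => by subst h; omega, fun w huw hwv => ?_⟩
    have h₁ := Submodule.finrank_lt_finrank_of_lt huw
    have h₂ := Submodule.finrank_lt_finrank_of_lt hwv
    omega
  · intro h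
    obtain ⟨x, hxv, hxu⟩ := SetLike.exists_of_lt h.lt
    have hx : Submodule.span F {x} ⊔ u = v := by
      have hle : Submodule.span F {x} ⊔ u ≤ v :=
        sup_le ((Submodule.span_singleton_le_iff_mem x v).2 hxv) h.le
      rcases h.eq_or_eq le_sup_right hle with h' | h'
      · exact absurd (h' ▸ Submodule.mem_sup_left (Submodule.mem_span_singleton_self x)) hxu
      · exact h'
    have hx0 : x ≠ 0 := fun h0 => hxu (h0 ▸ u.zero_mem)
    have hinf : Submodule.span F {x} ⊓ u = ⊥ :=
      ((Submodule.disjoint_span_singleton' hx0).2 hxu).symm.eq_bot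
    have hd := Submodule.finrank_sup_add_finrank_inf_eq (Submodule.span F {x}) u
    rw [hx, hinf, finrank_bot, finrank_span_singleton hx0] at hd
    exact ⟨h.le, by omega⟩

theorem backslashCovers_iff : BackslashCovers y u v ↔ u ⋖ v ∧ v ⊓ y ≤ u := by
  rw [BackslashCovers, covers_iff_covBy]
  refine and_congr_right fun h => ?_
  have hle : u ⊓ y ≤ v ⊓ y := inf_le_inf_right y h.le
  constructor
  · intro hd
    rw [← Submodule.eq_of_le_of_finrank_le hle hd.le]
    exact inf_le_left
  · intro hvy
    rw [le_antisymm (le_inf hvy inf_le_right) hle]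

theorem slashCovers_iff : SlashCovers y u v ↔ u ⋖ v ∧ ¬ v ⊓ y ≤ u := by
  rw [SlashCovers, covers_iff_covBy]
  refine and_congr_right fun h => ?_
  constructor
  · intro hd hvy
    have := (backslashCovers_iff.2 ⟨h, hvy⟩).2
    omega
  · intro hvy
    have hd := Submodule.finrank_sup_add_finrank_inf_eq u (v ⊓ y)
    rw [h.sup_inf_eq hvy, ← inf_assoc, inf_eq_left.2 h.le, (covers_iff_covBy.2 h).2] at hd
    omega

theorem backslashCovers_iff_inf_sup_le :
    BackslashCovers y u v ↔ Covers u v ∧ v ⊓ (u ⊔ y) ≤ u := by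
  rw [backslashCovers_iff, covers_iff_covBy]
  refine and_congr_right fun h => ?_
  rw [inf_comm v (u ⊔ y), sup_inf_assoc_of_le y h.le, inf_comm y, sup_le_iff]
  exact ⟨fun h => ⟨le_rfl, h⟩, And.right⟩

theorem backslash_slash_inf_iff_slash_backslash_sup :
    (BackslashCovers y (u ⊓ v) u ∧ SlashCovers y (u ⊓ v) v) ↔
      (SlashCovers y u (u ⊔ v) ∧ BackslashCovers y v (u ⊔ v)) := by
  simp only [backslashCovers_iff, slashCovers_iff]
  constructor
  · rintro ⟨⟨hu, huy⟩, hv, hvy⟩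
    have h₁ : u ⋖ u ⊔ v := covBy_sup_of_inf_covBy_of_inf_covBy_left hu hv
    have h₂ : v ⋖ u ⊔ v := covBy_sup_of_inf_covBy_of_inf_covBy_right hu hv
    have hvu : ¬ v ⊓ y ≤ u := fun h => hvy (le_inf h inf_le_left)
    have hx : ¬ (u ⊔ v) ⊓ y ≤ u := fun h => hvu ((inf_le_inf_right y le_sup_right).trans h)
    refine ⟨⟨h₁, hx⟩, h₂, ?_⟩
    have hsup : u ⊔ v ⊓ y = u ⊔ v :=
      (h₁.eq_or_eq le_sup_left (sup_le_sup_left inf_le_left u)).resolve_left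
        fun h' => hvu (h' ▸ le_sup_right)
    rw [← hsup, sup_comm, sup_inf_assoc_of_le u inf_le_right]
    exact sup_le inf_le_left (huy.trans inf_le_right)
  · rintro ⟨⟨hu, huy⟩, hv, hvy⟩
    refine ⟨⟨inf_covBy_of_covBy_sup_of_covBy_sup_left hu hv,
      le_inf inf_le_left ((inf_le_inf_right y le_sup_left).trans hvy)⟩,
      inf_covBy_of_covBy_sup_of_covBy_sup_right hu hv, fun h => huy ?_⟩
    exact (le_inf hvy inf_le_right).trans (h.trans inf_le_left)

theorem backslash_inf_iff :
    (BackslashCovers y (u ⊓ v) u ∧ BackslashCovers y (u ⊓ v) v) ↔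
      (BackslashCovers y u (u ⊔ v) ∧ BackslashCovers y v (u ⊔ v)) ∨
      (SlashCovers y u (u ⊔ v) ∧ SlashCovers y v (u ⊔ v) ∧
        BackslashCovers y (u ⊓ v) u ∧ BackslashCovers y (u ⊓ v) v) := by
  simp only [backslashCovers_iff, slashCovers_iff]
  constructor
  · rintro ⟨⟨hu, huy⟩, hv, hvy⟩
    have h₁ : u ⋖ u ⊔ v := covBy_sup_of_inf_covBy_of_inf_covBy_left hu hv
    have h₂ : v ⋖ u ⊔ v := covBy_sup_of_inf_covBy_of_inf_covBy_right hu hv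
    have huv : (u ⊔ v) ⊓ y ≤ u → (u ⊔ v) ⊓ y ≤ v := fun h =>
      (le_inf h inf_le_right).trans (huy.trans inf_le_right)
    have hvu : (u ⊔ v) ⊓ y ≤ v → (u ⊔ v) ⊓ y ≤ u := fun h =>
      (le_inf h inf_le_right).trans (hvy.trans inf_le_left)
    tauto
  · rintro (⟨⟨hu, huy⟩, hv, hvy⟩ | h)
    · exact ⟨⟨inf_covBy_of_covBy_sup_of_covBy_sup_left hu hv,
        le_inf inf_le_left ((inf_le_inf_right y le_sup_left).trans hvy)⟩,
        inf_covBy_of_covBy_sup_of_covBy_sup_right hu hv,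
        le_inf ((inf_le_inf_right y le_sup_right).trans huy) inf_le_left⟩
    · exact h.2.2

/-- The only chain from `u` to `v` made of a slash-cover followed by a backslash-cover passes
through `u ⊔ v ⊓ y`. -/
theorem slash_backslash_iff :
    (SlashCovers y u w ∧ BackslashCovers y w v) ↔
      w = u ⊔ v ⊓ y ∧ u ⋖ u ⊔ v ⊓ y ∧ u ⊔ v ⊓ y ⋖ v := by
  simp only [backslashCovers_iff, slashCovers_iff]
  constructor
  · rintro ⟨⟨hu, huy⟩, hv, hvy⟩
    have hw : w = u ⊔ v ⊓ y := by
      rw [← hu.sup_inf_eq huy]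
      congr 1
      exact le_antisymm (inf_le_inf_right y hv.le) (le_inf hvy inf_le_right)
    exact ⟨hw, hw ▸ hu, hw ▸ hv⟩
  · rintro ⟨rfl, hu, hv⟩
    refine ⟨⟨hu, fun h => hu.lt.ne' (sup_eq_left.2 (le_trans ?_ h))⟩, hv, le_sup_right⟩
    exact le_inf le_sup_right inf_le_right

theorem covBy_of_backslash_slash (hu : BackslashCovers y u w) (hv : SlashCovers y w v) :
    u ⋖ u ⊔ v ⊓ y ∧ u ⊔ v ⊓ y ⋖ v := by
  rw [backslashCovers_iff] at hu
  rw [slashCovers_iff] at hv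
  have hsup : w ⊔ (u ⊔ v ⊓ y) = v := by
    rw [← sup_assoc, sup_eq_left.2 hu.1.le, hv.1.sup_inf_eq hv.2]
  have hinf : w ⊓ (u ⊔ v ⊓ y) = u := by
    rw [inf_comm, sup_inf_assoc_of_le _ hu.1.le, inf_right_comm, inf_eq_right.2 hv.1.le,
      sup_eq_left.2 hu.2]
  constructor
  · have h : w ⋖ w ⊔ (u ⊔ v ⊓ y) := hsup.symm ▸ hv.1
    simpa only [hinf] using inf_covBy_of_covBy_sup_left h
  · have h : w ⊓ (u ⊔ v ⊓ y) ⋖ w := hinf.symm ▸ hu.1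
    simpa only [hsup] using covBy_sup_of_inf_covBy_left h

theorem backslash_slash_iff (hu : u ⋖ u ⊔ v ⊓ y) (hv : u ⊔ v ⊓ y ⋖ v) :
    (BackslashCovers y u w ∧ SlashCovers y w v) ↔
      Covers u w ∧ w ≤ v ∧ w ⊓ (u ⊔ v ⊓ y) ≤ u := by
  constructor
  · rintro ⟨h₁, h₂⟩
    refine ⟨h₁.1, h₂.1.1, ?_⟩
    rw [inf_comm, sup_inf_assoc_of_le _ h₁.1.1, inf_right_comm, inf_eq_right.2 h₂.1.1]
    exact sup_le le_rfl (backslashCovers_iff.1 h₁).2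
  · rintro ⟨h₁, hwv, hinf⟩
    have hwu := covers_iff_covBy.1 h₁
    refine ⟨backslashCovers_iff.2 ⟨hwu, le_trans ?_ hinf⟩,
      slashCovers_iff.2 ⟨covers_iff_covBy.1 ⟨hwv, ?_⟩, fun h => ?_⟩⟩
    · exact le_inf inf_le_left ((inf_le_inf_right y hwv).trans le_sup_right)
    · rw [(covers_iff_covBy.2 hv).2, (covers_iff_covBy.2 hu).2, h₁.2]
    · have : u ⊔ v ⊓ y ≤ w := sup_le h₁.1 h
      exact hu.lt.not_ge ((le_inf this le_rfl).trans hinf)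

end CoverLemmas

section Counting

/-- Between `u` and `s`, the number of covers of `u` that meet `p` in `u`. -/
theorem ncard_covers_mul [Fintype F] [FiniteDimensional F V] {u p s : Submodule F V}
    (hup : u ≤ p) (hps : p ≤ s) :
    {w | Covers u w ∧ w ≤ s ∧ w ⊓ p ≤ u}.ncard *
        (Fintype.card F ^ (Module.finrank F u + 1) - Fintype.card F ^ Module.finrank F u) =
      Fintype.card F ^ Module.finrank F s - Fintype.card F ^ Module.finrank F p := by
  have : Finite V := Module.finite_of_finite F
  have : Finite (Submodule F V) := Finite.of_injective _ SetLike.coe_injective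
  let := Fintype.ofFinite V
  let := Fintype.ofFinite (Submodule F V)
  have hcard (w : Submodule F V) :
      (w : Set V).toFinset.card = Fintype.card F ^ Module.finrank F w := by
    rw [← Module.card_eq_pow_finrank (K := F) (V := w), Set.toFinset_card]
    rfl
  have hdiff {a b : Submodule F V} (hab : a ≤ b) :
      ((b : Set V).toFinset \ (a : Set V).toFinset).card =
        Fintype.card F ^ Module.finrank F b - Fintype.card F ^ Module.finrank F a := by
    rw [Finset.card_sdiff_of_subset (by simpa using hab), hcard, hcard]
  rw [Set.ncard_eq_toFinset_card', ← hdiff hps]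
  have hunion : (s : Set V).toFinset \ (p : Set V).toFinset =
      {w | Covers u w ∧ w ≤ s ∧ w ⊓ p ≤ u}.toFinset.biUnion
        fun w => (w : Set V).toFinset \ (u : Set V).toFinset := by
    ext x
    simp only [Finset.mem_sdiff, Set.mem_toFinset, SetLike.mem_coe, Finset.mem_biUnion,
      Set.mem_ofPred_eq]
    constructor
    · rintro ⟨hxs, hxp⟩
      have hxu : x ∉ u := fun h => hxp (hup h)
      have hcov := Submodule.covBy_span_singleton_sup hxu
      have hx : x ∈ Submodule.span F {x} ⊔ u :=
        Submodule.mem_sup_left (Submodule.mem_span_singleton_self x)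
      refine ⟨_, ⟨covers_iff_covBy.2 hcov, sup_le ?_ (hup.trans hps), ?_⟩, hx, hxu⟩
      · exact (Submodule.span_singleton_le_iff_mem x s).2 hxs
      · rcases hcov.eq_or_eq (le_inf hcov.le hup) inf_le_left with h | h
        · exact h.le
        · exact absurd (inf_eq_left.1 h hx) hxp
    · rintro ⟨w, ⟨-, hws, hwp⟩, hxw, hxu⟩
      exact ⟨hws hxw, fun hxp => hxu (hwp ⟨hxw, hxp⟩)⟩
  rw [hunion, Finset.card_biUnion, Finset.sum_const_nat]
  · intro w hw
    have hc : Covers u w := (Set.mem_toFinset.1 hw).1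
    rw [hdiff hc.1, hc.2]
  · intro w hw w' hw' hne
    have hc := covers_iff_covBy.1 (Set.mem_toFinset.1 hw).1
    have hc' := covers_iff_covBy.1 (Set.mem_toFinset.1 hw').1
    refine Finset.disjoint_left.2 fun x hx hx' => ?_
    simp only [Finset.mem_sdiff, Set.mem_toFinset, SetLike.mem_coe] at hx hx'
    exact hx.2 ((hc.eq_inf_of_ne hc' hne).ge ⟨hx.1, hx'.1⟩)

/-- The number of hyperplanes of `u` containing `s`. -/
theorem ncard_coveredBy_mul [Fintype F] [FiniteDimensional F V] {u s : Submodule F V}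
    (hsu : s ≤ u) :
    {w | Covers w u ∧ s ≤ w}.ncard * (Fintype.card F - 1) =
      Fintype.card F ^ (Module.finrank F u - Module.finrank F s) - 1 := by
  have hpos : 0 < Fintype.card F := Fintype.card_pos
  have himage : Submodule.dualAnnihilator '' {w | Covers w u ∧ s ≤ w} =
      {w | Covers u.dualAnnihilator w ∧ w ≤ s.dualAnnihilator ∧
        w ⊓ u.dualAnnihilator ≤ u.dualAnnihilator} := by
    have hcov (w : Submodule F V) :
        Covers u.dualAnnihilator w.dualAnnihilator ↔ Covers w u := by
      have h₁ := Subspace.finrank_add_finrank_dualAnnihilator_eq u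
      have h₂ := Subspace.finrank_add_finrank_dualAnnihilator_eq w
      rw [Covers, Covers, Subspace.dualAnnihilator_le_dualAnnihilator_iff]
      refine and_congr_right fun _ => ?_
      omega
    ext w
    constructor
    · rintro ⟨w, ⟨hwu, hsw⟩, rfl⟩
      exact ⟨(hcov w).2 hwu, Submodule.dualAnnihilator_anti hsw, inf_le_right⟩
    · rintro ⟨hwu, hsw, -⟩
      obtain ⟨w, rfl⟩ : ∃ w' : Submodule F V, w'.dualAnnihilator = w :=
        ⟨_, Subspace.dualCoannihilator_dualAnnihilator_eq⟩
      exact ⟨w, ⟨(hcov w).1 hwu, Subspace.dualAnnihilator_le_dualAnnihilator_iff.1 hsw⟩, rfl⟩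
  have key := ncard_covers_mul (le_refl u.dualAnnihilator) (Submodule.dualAnnihilator_anti hsu)
  rw [← himage, Set.ncard_image_of_injective _ fun _ _ => Subspace.dualAnnihilator_inj.1] at key
  have hd : Module.finrank F s.dualAnnihilator =
      Module.finrank F u - Module.finrank F s + Module.finrank F u.dualAnnihilator := by
    have h₁ := Subspace.finrank_add_finrank_dualAnnihilator_eq u
    have h₂ := Subspace.finrank_add_finrank_dualAnnihilator_eq s
    have h₃ := Submodule.finrank_mono hsu
    omega
  refine Nat.eq_of_mul_eq_mul_right (pow_pos hpos (Module.finrank F u.dualAnnihilator)) ?_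
  rw [hd] at key
  rw [mul_assoc, Nat.sub_mul, Nat.sub_mul, one_mul, ← pow_succ', ← pow_add]
  exact key

end Counting

section MatrixRelations

theorem sum_ite_mul_ite {ι : Type*} [Fintype ι] (A B : ι → Prop) :
    ∑ w, (if A w then (1 : ℂ) else 0) * (if B w then (1 : ℂ) else 0) =
      ({w | A w ∧ B w}.ncard : ℂ) := by
  simp only [← ite_and, mul_ite, mul_one, mul_zero, Finset.sum_boole,
    Set.ncard_eq_toFinset_card', Set.toFinset_ofPred, and_comm]

theorem ncard_eq_ite_of_forall_eq {ι : Type*} {P : ι → Prop} {a : ι} [Decidable (P a)]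
    (h : ∀ w, P w → w = a) :
    ({w | P w}.ncard : ℂ) = if P a then 1 else 0 := by
  split_ifs with ha
  · have : {w | P w} = {a} := by
      ext w
      exact ⟨h w, fun hw => (Set.mem_singleton_iff.1 hw) ▸ ha⟩
    rw [this, Set.ncard_singleton, Nat.cast_one]
  · have : {w | P w} = ∅ := by
      ext w
      exact ⟨fun hw => ha (h w hw ▸ hw), False.elim⟩
    rw [this, Set.ncard_empty, Nat.cast_zero]

theorem ite_or_of_not_and {p r : Prop} [Decidable p] [Decidable r] (h : ¬ (p ∧ r)) :
    (if p ∨ r then (1 : ℂ) else 0) = (if p then 1 else 0) + if r then 1 else 0 := by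
  by_cases hp : p <;> by_cases hr : r <;> simp_all

variable [FiniteDimensional F V] [Fintype (Submodule F V)] (y : Submodule F V)

theorem matR2_mul_matL1 : matR2 y * matL1 y = matL1 y * matR2 y := by
  ext u v
  simp only [Matrix.mul_apply, matR2, matL1, matL2, Matrix.transpose_apply, Matrix.of_apply,
    sum_ite_mul_ite]
  by_cases huv : u = v
  · subst huv
    have h₁ : {w | BackslashCovers y w u ∧ SlashCovers y w u} = ∅ := by
      ext w
      exact ⟨fun h => (slashCovers_iff.1 h.2).2 (backslashCovers_iff.1 h.1).2, False.elim⟩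
    have h₂ : {w | SlashCovers y u w ∧ BackslashCovers y u w} = ∅ := by
      ext w
      exact ⟨fun h => (slashCovers_iff.1 h.1).2 (backslashCovers_iff.1 h.2).2, False.elim⟩
    rw [h₁, h₂]
  · rw [ncard_eq_ite_of_forall_eq (a := u ⊓ v), ncard_eq_ite_of_forall_eq (a := u ⊔ v),
      if_congr backslash_slash_inf_iff_slash_backslash_sup rfl rfl]
    · exact fun w h => (covers_iff_covBy.1 h.1.1).eq_sup_of_ne (covers_iff_covBy.1 h.2.1) huv
    · exact fun w h => (covers_iff_covBy.1 h.1.1).eq_inf_of_ne (covers_iff_covBy.1 h.2.1) huv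

theorem matL2_mul_matR2 :
    matL2 y * matR2 y =
      matFp y + Matrix.diagonal fun u => ({w | BackslashCovers y u w}.ncard : ℂ) := by
  ext u v
  simp only [Matrix.mul_apply, matR2, matL2, matFp, Matrix.transpose_apply, Matrix.of_apply,
    sum_ite_mul_ite, Matrix.add_apply]
  by_cases huv : u = v
  · subst huv
    have h : ¬ BackslashCovers y u u := fun h => (covers_iff_covBy.1 h.1).lt.ne rfl
    simp [h]
  · rw [ncard_eq_ite_of_forall_eq (a := u ⊔ v), Matrix.diagonal_apply_ne _ huv, add_zero]
    exact fun w h => (covers_iff_covBy.1 h.1.1).eq_sup_of_ne (covers_iff_covBy.1 h.2.1) huv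

theorem matR2_mul_matL2 :
    matR2 y * matL2 y =
      matFp y + matF0 y + Matrix.diagonal fun u => ({w | BackslashCovers y w u}.ncard : ℂ) := by
  ext u v
  simp only [Matrix.mul_apply, matR2, matL2, matFp, matF0, Matrix.transpose_apply,
    Matrix.of_apply, sum_ite_mul_ite, Matrix.add_apply]
  by_cases huv : u = v
  · subst huv
    have h : ¬ BackslashCovers y u u := fun h => (covers_iff_covBy.1 h.1).lt.ne rfl
    simp [h]
  · rw [ncard_eq_ite_of_forall_eq (a := u ⊓ v), Matrix.diagonal_apply_ne _ huv, add_zero,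
      if_congr backslash_inf_iff rfl rfl]
    · exact ite_or_of_not_and fun h =>
        (slashCovers_iff.1 h.2.1).2 (backslashCovers_iff.1 h.1.1).2
    · exact fun w h => (covers_iff_covBy.1 h.1.1).eq_inf_of_ne (covers_iff_covBy.1 h.2.1) huv

theorem matL2_mul_matL1 [Fintype F] :
    matL2 y * matL1 y = (Fintype.card F : ℂ) • (matL1 y * matL2 y) := by
  ext u v
  simp only [Matrix.mul_apply, matL1, matL2, Matrix.of_apply, sum_ite_mul_ite,
    Matrix.smul_apply, smul_eq_mul]
  by_cases h : u ⋖ u ⊔ v ⊓ y ∧ u ⊔ v ⊓ y ⋖ v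
  · have h₁ : {w | SlashCovers y u w ∧ BackslashCovers y w v} = {u ⊔ v ⊓ y} := by
      ext w
      exact slash_backslash_iff.trans (and_iff_left h)
    have h₂ : {w | BackslashCovers y u w ∧ SlashCovers y w v} =
        {w | Covers u w ∧ w ≤ v ∧ w ⊓ (u ⊔ v ⊓ y) ≤ u} := by
      ext w
      exact backslash_slash_iff h.1 h.2
    have key := ncard_covers_mul h.1.le h.2.le
    rw [(covers_iff_covBy.2 h.2).2, (covers_iff_covBy.2 h.1).2, ← h₂,
      pow_succ' _ (Module.finrank F u + 1), pow_succ', ← Nat.mul_sub] at key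
    have hF : 1 < Fintype.card F := Fintype.one_lt_card
    have hpos : 0 < Fintype.card F * Fintype.card F ^ Module.finrank F u -
        Fintype.card F ^ Module.finrank F u :=
      Nat.sub_pos_of_lt (lt_mul_of_one_lt_left (pow_pos (by omega) _) hF)
    rw [Nat.eq_of_mul_eq_mul_right hpos key, h₁, Set.ncard_singleton, Nat.cast_one, mul_one]
  · have h₁ : {w | SlashCovers y u w ∧ BackslashCovers y w v} = ∅ := by
      ext w
      exact ⟨fun hw => h (slash_backslash_iff.1 hw).2, False.elim⟩
    have h₂ : {w | BackslashCovers y u w ∧ SlashCovers y w v} = ∅ := by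
      ext w
      exact ⟨fun hw => h (covBy_of_backslash_slash hw.1 hw.2), False.elim⟩
    rw [h₁, h₂, Set.ncard_empty, Nat.cast_zero, mul_zero]

/-- The combination of `F0`, `F+` and `R` reduces to diagonal multiples of `R`. -/
theorem smul_matR_mul_matFp_sub [Fintype F] :
    (Fintype.card F : ℂ) • (matR y * matFp y) - matFp y * matR y - matF0 y * matR y =
      (Matrix.diagonal fun u => ({w | BackslashCovers y w u}.ncard : ℂ)) * matR y -
      (Fintype.card F : ℂ) •
        (matR y * Matrix.diagonal fun u => ({w | BackslashCovers y u w}.ncard : ℂ)) := by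
  have hp := eq_sub_of_add_eq (matL2_mul_matR2 y).symm
  have h0 := eq_sub_of_add_eq (matR2_mul_matL2 y).symm
  have hcomm : matR2 y * matL2 y * matR y =
      (Fintype.card F : ℂ) • (matR y * (matL2 y * matR2 y)) := by
    rw [matR, mul_assoc, ← mul_assoc (matL2 y), matL2_mul_matL1, smul_mul_assoc, mul_smul_comm,
      ← matR2_mul_matL1]
    simp only [mul_assoc]
  rw [sub_sub, ← add_mul, h0, hp, sub_mul, mul_sub, hcomm, smul_sub]
  abel

end MatrixRelations

section Numeric

theorem ncard_backslashCovers_mul [Fintype F] [FiniteDimensional F V] (y v : Submodule F V) :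
    ({w | BackslashCovers y v w}.ncard : ℂ) * ((Fintype.card F : ℂ) - 1) *
        (Fintype.card F : ℂ) ^ Module.finrank F v =
      (Fintype.card F : ℂ) ^ Module.finrank F V -
        (Fintype.card F : ℂ) ^ Module.finrank F ↥(v ⊔ y) := by
  have hF : 1 ≤ Fintype.card F := Fintype.card_pos
  have hset : {w | BackslashCovers y v w} =
      {w | Covers v w ∧ w ≤ ⊤ ∧ w ⊓ (v ⊔ y) ≤ v} := by
    ext w
    simpa only [Set.mem_ofPred_eq, le_top, true_and] using backslashCovers_iff_inf_sup_le
  have key := ncard_covers_mul (le_sup_left : v ≤ v ⊔ y) le_top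
  rw [← hset, finrank_top] at key
  have hcast := congrArg (Nat.cast : ℕ → ℂ) key
  rw [Nat.cast_mul, Nat.cast_sub (Nat.pow_le_pow_right hF (Nat.le_add_right _ 1)),
    Nat.cast_sub (Nat.pow_le_pow_right hF (Submodule.finrank_le _))] at hcast
  push_cast at hcast
  rw [← hcast, pow_succ]
  ring

theorem ncard_backslashCovered_mul [Fintype F] [FiniteDimensional F V] (y u : Submodule F V) :
    ({w | BackslashCovers y w u}.ncard : ℂ) * ((Fintype.card F : ℂ) - 1) =
      (Fintype.card F : ℂ) ^ (Module.finrank F u - Module.finrank F ↥(u ⊓ y)) - 1 := by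
  have hF : 1 ≤ Fintype.card F := Fintype.card_pos
  have hset : {w | BackslashCovers y w u} = {w | Covers w u ∧ u ⊓ y ≤ w} := by
    ext w
    simp only [Set.mem_ofPred_eq, covers_iff_covBy, backslashCovers_iff]
  have hcast := congrArg (Nat.cast : ℕ → ℂ)
    (ncard_coveredBy_mul (inf_le_left : u ⊓ y ≤ u))
  rw [← hset, Nat.cast_mul, Nat.cast_sub hF, Nat.cast_sub (Nat.one_le_pow _ _ hF)] at hcast
  exact_mod_cast hcast

theorem qpow_add {q : ℕ} (hq : 0 < q) (a b : ℝ) : qpow q (a + b) = qpow q a * qpow q b := by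
  rw [qpow, qpow, qpow, Real.rpow_add (by exact_mod_cast hq), Complex.ofReal_mul]

theorem qpow_zero (q : ℕ) : qpow q 0 = 1 := by
  simp [qpow]

theorem qpow_natCast (q m : ℕ) : qpow q m = (q : ℂ) ^ m := by
  simp [qpow]

theorem inv_matK2 [Fintype (Submodule F V)] {q : ℕ} (hq : 0 < q) (n k : ℕ)
    (y : Submodule F V) :
    (matK2 q n k y)⁻¹ = Matrix.diagonal fun u : Submodule F V =>
      qpow q (((n : ℝ) - (k : ℝ)) / 2 -
        ((Module.finrank F ↥u : ℝ) - (Module.finrank F ↥(u ⊓ y) : ℝ))) := by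
  refine Matrix.inv_eq_right_inv ?_
  rw [matK2, Matrix.diagonal_mul_diagonal, ← Matrix.diagonal_one]
  congr 1
  ext u
  rw [← qpow_add hq, ← qpow_zero q]
  congr 1
  ring

/-- The coefficient identity satisfied whenever `R` has a nonzero `(u, v)` entry. -/
theorem ncard_backslashCovers_relation [Fintype F] [FiniteDimensional F V]
    {y u v w : Submodule F V} (hu : SlashCovers y u w) (hv : BackslashCovers y v w) :
    (({w | BackslashCovers y w u}.ncard : ℂ) -
        (Fintype.card F : ℂ) * ({w | BackslashCovers y v w}.ncard : ℂ)) *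
        ((Fintype.card F : ℂ) - 1) +
      ((Fintype.card F : ℂ) ^ (Module.finrank F V - Module.finrank F u + 1) -
        (Fintype.card F : ℂ) ^ (Module.finrank F y - Module.finrank F ↥(u ⊓ y)) -
        (Fintype.card F : ℂ) ^ (Module.finrank F u - Module.finrank F ↥(u ⊓ y)) + 1) = 0 := by
  have hD := ncard_backslashCovers_mul y v
  have hE := ncard_backslashCovered_mul y u
  have hF : (Fintype.card F : ℂ) ≠ 0 := by exact_mod_cast Fintype.card_ne_zero
  have h₁ := hu.1.2
  have h₂ := hv.1.2
  have h₃ := hu.2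
  have h₄ := hv.2
  have h₅ := Submodule.finrank_sup_add_finrank_inf_eq v y
  have h₆ : Module.finrank F ↥(v ⊓ y) ≤ Module.finrank F y :=
    Submodule.finrank_mono inf_le_right
  have h₇ := Submodule.finrank_le u
  have hvu : Module.finrank F v = Module.finrank F u := by omega
  have hsup : Module.finrank F ↥(v ⊔ y) + 1 =
      Module.finrank F u + (Module.finrank F y - Module.finrank F ↥(u ⊓ y)) := by omega
  have hV : Module.finrank F V + 1 =
      Module.finrank F u + (Module.finrank F V - Module.finrank F u + 1) := by omega
  rw [hvu] at hD
  have hD' : (Fintype.card F : ℂ) * ({w | BackslashCovers y v w}.ncard : ℂ) *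
      ((Fintype.card F : ℂ) - 1) =
      (Fintype.card F : ℂ) ^ (Module.finrank F V - Module.finrank F u + 1) -
        (Fintype.card F : ℂ) ^ (Module.finrank F y - Module.finrank F ↥(u ⊓ y)) := by
    refine mul_left_cancel₀ (pow_ne_zero (Module.finrank F u) hF) ?_
    rw [mul_sub (_ ^ _) (_ ^ _), ← pow_add, ← pow_add, ← hsup, ← hV, pow_succ, pow_succ, ← sub_mul, ← hD]
    ring
  linear_combination hE - hD'

end Numeric

theorem statement1
    (q n k : ℕ) (hq : IsPrimePow q) (hkn : k < n) (hk : 1 ≤ k)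
    (F V : Type) [Field F] [Fintype F] (hcard : Fintype.card F = q)
    [AddCommGroup V] [Module F V] [FiniteDimensional F V]
    (hdim : Module.finrank F V = n)
    [Fintype (Submodule F V)]
    (y : Submodule F V) (hy : Module.finrank F ↥y = k) :
    (q : ℂ) • (matR y * matFp y) - matFp y * matR y - matF0 y * matR y +
      (((q : ℂ) - 1)⁻¹ • (qpow q ((n : ℝ) / 2 + 1) • (matK1 q k y * (matK2 q n k y)⁻¹)
        - qpow q ((k : ℝ) / 2) • matK1 q k y - qpow q (((n : ℝ) - (k : ℝ)) / 2) • matK2 q n k y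
        + (1 : Matrix (Submodule F V) (Submodule F V) ℂ))) * matR y = 0 := by
  subst hcard hdim hy
  have hq0 : 0 < Fintype.card F := Fintype.card_pos
  have hq1 : (Fintype.card F : ℂ) - 1 ≠ 0 :=
    sub_ne_zero.2 (by exact_mod_cast (Fintype.one_lt_card (α := F)).ne')
  rw [smul_matR_mul_matFp_sub, inv_matK2 hq0, matK1, matK2, Matrix.diagonal_mul_diagonal]
  ext u v
  simp only [← Matrix.diagonal_one, ← Matrix.diagonal_smul, Matrix.diagonal_sub,
    Matrix.diagonal_add, Matrix.add_apply, Matrix.sub_apply, Matrix.smul_apply,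
    Matrix.diagonal_mul, Matrix.mul_diagonal, Matrix.zero_apply, Pi.smul_apply, smul_eq_mul,
    ← qpow_add hq0]
  by_cases hR : matR y u v = 0
  · rw [hR]
    ring
  obtain ⟨w, hu, hv⟩ : ∃ w, SlashCovers y u w ∧ BackslashCovers y v w := by
    rw [matR, Matrix.mul_apply] at hR
    obtain ⟨w, -, hw⟩ := Finset.exists_ne_zero_of_sum_ne_zero hR
    simp only [matL1, matR2, matL2, Matrix.transpose_apply, Matrix.of_apply, ne_eq,
      mul_eq_zero, ite_eq_right_iff, one_ne_zero, imp_false, not_or, not_not] at hw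
    exact ⟨w, hw⟩
  have hrel := ncard_backslashCovers_relation hu hv
  simp only [← qpow_natCast] at hrel
  have h₁ := Submodule.finrank_le u
  have h₂ : Module.finrank F ↥(u ⊓ y) ≤ Module.finrank F y :=
    Submodule.finrank_mono inf_le_right
  have h₃ : Module.finrank F ↥(u ⊓ y) ≤ Module.finrank F u :=
    Submodule.finrank_mono inf_le_left
  push_cast [Nat.cast_sub h₁, Nat.cast_sub h₂, Nat.cast_sub h₃] at hrel
  generalize (Module.finrank F V : ℝ) = n, (Module.finrank F y : ℝ) = k,
    (Module.finrank F u : ℝ) = d, (Module.finrank F ↥(u ⊓ y) : ℝ) = i at hrel ⊢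
  rw [show n / 2 + 1 + (k / 2 - i + ((n - k) / 2 - (d - i))) = n - d + 1 by ring,
    show k / 2 + (k / 2 - i) = k - i by ring,
    show (n - k) / 2 + (d - i - (n - k) / 2) = d - i by ring]
  field_simp
  linear_combination matR y u v * hrel
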